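/- Let $C\subseteq\mathbb{R}^d$ be a pointed full-dimensional rational cone that fails (ICP). Suppose $C$ is minimal first with respect to dimension and second with respect to the cardinality of its Hilbert basis: every pointed full-dimensional rational cone of dimension $<d$ satisfies (ICP), and every pointed full-dimensional rational cone in $\mathbb{R}^d$ whose Hilbert basis has fewer elements than $\operatorname{Hilb}(C)$ satisfies (ICP). Then $C$ is tight: every element of $\operatorname{Hilb}(C)$ is destructive. -/

import Mathlib

/-- The real vector corresponding to an integer vector. -/
def toR {d : ℕ} (x : Fin d → ℤ) : Fin d → ℝ := fun i => (x i : ℝ)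

/-- The cone generated by a finite family of integer vectors. -/
def coneFin {d n : ℕ} (v : Fin n → (Fin d → ℤ)) : Set (Fin d → ℝ) :=
  { y | ∃ a : Fin n → ℝ, (∀ i, 0 ≤ a i) ∧ y = ∑ i, a i • toR (v i) }

/-- The cone generated by a set of integer vectors (nonnegative real combinations
of finitely many of its elements). -/
def coneSet {d : ℕ} (B : Set (Fin d → ℤ)) : Set (Fin d → ℝ) :=
  { y | ∃ (n : ℕ) (v : Fin n → (Fin d → ℤ)) (a : Fin n → ℝ),
      (∀ i, v i ∈ B) ∧ (∀ i, 0 ≤ a i) ∧ y = ∑ i, a i • toR (v i) }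

/-- A finitely generated rational cone. -/
def IsRatCone {d : ℕ} (C : Set (Fin d → ℝ)) : Prop :=
  ∃ B : Finset (Fin d → ℤ), C = coneSet (B : Set (Fin d → ℤ))

/-- A pointed cone: `x, -x ∈ C` implies `x = 0`. -/
def PointedSet {d : ℕ} (C : Set (Fin d → ℝ)) : Prop :=
  ∀ x ∈ C, -x ∈ C → x = 0

/-- A full-dimensional subset of `ℝ^d`. -/
def FullDim {d : ℕ} (C : Set (Fin d → ℝ)) : Prop :=
  Submodule.span ℝ C = ⊤

/-- The Hilbert basis of the monoid `C ∩ ℤ^d`: the nonzero lattice points of `C`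
admitting no decomposition into two nonzero lattice points of `C`. -/
def hilbC {d : ℕ} (C : Set (Fin d → ℝ)) : Set (Fin d → ℤ) :=
  { z | toR z ∈ C ∧ z ≠ 0 ∧
    ¬∃ u v : Fin d → ℤ, toR u ∈ C ∧ toR v ∈ C ∧ u ≠ 0 ∧ v ≠ 0 ∧ z = u + v }

/-- `C` satisfies (ICP): every lattice point of `C` is a nonnegative integral
combination of at most `d` elements of `Hilb(C)`. -/
def ICPcone {d : ℕ} (C : Set (Fin d → ℝ)) : Prop :=
  ∀ x : Fin d → ℤ, toR x ∈ C → ∃ (s : Finset (Fin d → ℤ)) (a : (Fin d → ℤ) → ℕ),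
    (s : Set (Fin d → ℤ)) ⊆ hilbC C ∧ s.card ≤ d ∧ x = ∑ y ∈ s, a y • y

/-- `x ∈ Hilb(C)` is destructive if `H' = Hilb(C) \ {x}` is not the Hilbert
basis of the cone `ℝ₊H'`; `C` is tight if every Hilbert basis element is
destructive. -/
def Tight {d : ℕ} (C : Set (Fin d → ℝ)) : Prop :=
  ∀ x ∈ hilbC C, hilbC (coneSet (hilbC C \ {x})) ≠ hilbC C \ {x}

open scoped NNReal

section ToR

variable {d : ℕ}

lemma toR_zero : toR (0 : Fin d → ℤ) = 0 := by ext; simp [toR]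

lemma toR_add (u v : Fin d → ℤ) : toR (u + v) = toR u + toR v := by ext; simp [toR]

lemma toR_sub (u v : Fin d → ℤ) : toR (u - v) = toR u - toR v := by ext; simp [toR]

lemma toR_zsmul (n : ℤ) (u : Fin d → ℤ) : toR (n • u) = (n : ℝ) • toR u := by ext; simp [toR]

lemma toR_injective : Function.Injective (toR : (Fin d → ℤ) → Fin d → ℝ) := by
  intro u v h
  ext i
  have hi : (u i : ℝ) = v i := congrFun h i
  exact_mod_cast hi

lemma toR_eq_zero {u : Fin d → ℤ} : toR u = 0 ↔ u = 0 := by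
  rw [← toR_zero, toR_injective.eq_iff]

lemma one_le_norm_toR {u : Fin d → ℤ} (hu : u ≠ 0) : 1 ≤ ‖toR u‖ := by
  obtain ⟨i, hi⟩ := Function.ne_iff.1 hu
  refine le_trans ?_ (norm_le_pi_norm (toR u) i)
  have : (1 : ℤ) ≤ |u i| := Int.one_le_abs hi
  simp only [toR, Real.norm_eq_abs]
  exact_mod_cast this

lemma finite_norm_toR_le (R : ℝ) : {u : Fin d → ℤ | ‖toR u‖ ≤ R}.Finite := by
  refine (Set.finite_Icc (fun _ => -⌈R⌉ : Fin d → ℤ) (fun _ => ⌈R⌉)).subset fun u hu => ?_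
  have h (i : Fin d) : |u i| ≤ ⌈R⌉ := by
    have h1 : |(u i : ℝ)| ≤ R := (norm_le_pi_norm (toR u) i).trans hu
    have h2 : ((|u i| : ℤ) : ℝ) ≤ (⌈R⌉ : ℝ) := by
      push_cast
      exact h1.trans (Int.le_ceil R)
    exact_mod_cast h2
  exact ⟨fun i => (abs_le.1 (h i)).1, fun i => (abs_le.1 (h i)).2⟩

end ToR

section ConeSet

variable {d : ℕ}

lemma coneSet_eq_span (B : Set (Fin d → ℤ)) :
    coneSet B = (Submodule.span ℝ≥0 (toR '' B) : Set (Fin d → ℝ)) := by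
  ext y
  rw [SetLike.mem_coe, Submodule.mem_span_set']
  constructor
  · rintro ⟨n, v, a, hv, ha, rfl⟩
    exact ⟨n, fun i => ⟨a i, ha i⟩, fun i => ⟨toR (v i), v i, hv i, rfl⟩, rfl⟩
  · rintro ⟨n, a, g, rfl⟩
    choose v hv hg using fun i => (g i).2
    exact ⟨n, v, fun i => a i, hv, fun i => (a i).2, by simp [hg, NNReal.smul_def]⟩

lemma IsRatCone.exists_submodule {C : Set (Fin d → ℝ)} (hC : IsRatCone C) :
    ∃ K : Submodule ℝ≥0 (Fin d → ℝ), C = K := by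
  obtain ⟨B, rfl⟩ := hC
  exact ⟨_, coneSet_eq_span _⟩

lemma Submodule.real_smul_mem {K : Submodule ℝ≥0 (Fin d → ℝ)} {c : Fin d → ℝ} (hc : c ∈ K)
    {t : ℝ} (ht : 0 ≤ t) : t • c ∈ K :=
  K.smul_mem ⟨t, ht⟩ hc

lemma exists_norm_le_functional {B : Finset (Fin d → ℤ)}
    (hp : PointedSet (coneSet (B : Set (Fin d → ℤ)))) :
    ∃ f : (Fin d → ℝ) →L[ℝ] ℝ, ∀ c ∈ coneSet (B : Set (Fin d → ℤ)), ‖c‖ ≤ f c := by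
  classical
  rw [coneSet_eq_span] at *
  set K := Submodule.span ℝ≥0 (toR '' (B : Set (Fin d → ℤ)))
  set S : Finset (Fin d → ℝ) := (B.image toR).erase 0 with hS
  have hSK {y} (hy : y ∈ S) : y ∈ K := by
    refine Submodule.subset_span ?_
    have := Finset.mem_of_mem_erase hy
    simpa using this
  have h0 : (0 : Fin d → ℝ) ∉ convexHull ℝ (S : Set (Fin d → ℝ)) := by
    rw [Finset.mem_convexHull']
    rintro ⟨w, hw, hw1, hw0⟩
    obtain ⟨y, hy, hwy⟩ : ∃ y ∈ S, w y ≠ 0 := by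
      by_contra! h
      rw [Finset.sum_eq_zero h] at hw1
      exact zero_ne_one hw1
    have hneg : -(w y • y) ∈ K := by
      rw [← Finset.add_sum_erase S _ hy, add_comm, ← eq_neg_iff_add_eq_zero] at hw0
      rw [← hw0]
      exact K.sum_mem fun z hz =>
        Submodule.real_smul_mem (hSK (Finset.mem_of_mem_erase hz)) (hw z (Finset.mem_of_mem_erase hz))
    have := hp _ (Submodule.real_smul_mem (hSK hy) (hw y hy)) hneg
    rcases smul_eq_zero.1 this with h | h
    · exact hwy h
    · exact (Finset.ne_of_mem_erase hy) h
  obtain ⟨f, u, hu, hf⟩ := geometric_hahn_banach_point_closed (convex_convexHull ℝ _)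
    (S.finite_toSet.isClosed_convexHull ℝ) h0
  rw [map_zero] at hu
  set M : ℝ := ∑ y ∈ S, ‖y‖
  refine ⟨(M / u) • f, fun c hc => ?_⟩
  induction hc using Submodule.span_induction with
  | mem y hy =>
    by_cases h : y = 0
    · simp [h]
    have hyS : y ∈ S := by
      rw [hS, Finset.mem_erase]
      exact ⟨h, by simpa using hy⟩
    have h1 : ‖y‖ ≤ M := Finset.single_le_sum (f := fun y => ‖y‖) (fun _ _ => norm_nonneg _) hyS
    have h2 : u < f y := hf y (subset_convexHull ℝ _ hyS)
    have hM : 0 ≤ M := (norm_nonneg y).trans h1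
    calc ‖y‖ ≤ M / u * u := by rwa [div_mul_cancel₀ _ hu.ne']
      _ ≤ M / u * f y := by gcongr
  | zero => simp
  | add y z _ _ hy hz =>
    rw [map_add]
    exact (norm_add_le y z).trans (add_le_add hy hz)
  | smul a y _ hy =>
    rw [NNReal.smul_def, map_smul, norm_smul, smul_eq_mul, Real.norm_of_nonneg a.coe_nonneg]
    exact mul_le_mul_of_nonneg_left hy a.2

lemma finite_hilbC {C : Set (Fin d → ℝ)} (hC : IsRatCone C) : (hilbC C).Finite := by
  obtain ⟨B, rfl⟩ := hC
  refine (finite_norm_toR_le (∑ y ∈ B, ‖toR y‖)).subset ?_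
  rintro z ⟨hz, hz0, hirr⟩
  have hz' := hz
  rw [coneSet_eq_span, SetLike.mem_coe, Submodule.mem_span_image_finset_iff_exists_fun'] at hz'
  obtain ⟨a, ha⟩ := hz'
  have hsmul (v : Fin d → ℤ) (t : ℝ≥0) : t • toR v = (t : ℝ) • toR v := rfl
  by_cases h : ∃ v ∈ B, v ≠ 0 ∧ 1 ≤ a v
  · obtain ⟨v, hv, hv0, hav⟩ := h
    have hvC : toR v ∈ coneSet (B : Set (Fin d → ℤ)) := by
      rw [coneSet_eq_span]
      exact Submodule.subset_span ⟨v, hv, rfl⟩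
    have hsub : toR (z - v) ∈ coneSet (B : Set (Fin d → ℤ)) := by
      rw [coneSet_eq_span, SetLike.mem_coe, toR_sub, ← ha, ← Finset.add_sum_erase B _ hv,
        add_sub_right_comm]
      refine add_mem ?_ (Submodule.sum_mem _ fun w hw => Submodule.smul_mem _ _
        (Submodule.subset_span ⟨w, Finset.mem_of_mem_erase hw, rfl⟩))
      have : a v • toR v - toR v = (a v - 1) • toR v := by
        rw [hsmul, hsmul, NNReal.coe_sub hav, NNReal.coe_one, sub_smul, one_smul]
      rw [this]
      exact Submodule.smul_mem _ _ (Submodule.subset_span ⟨v, hv, rfl⟩)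
    have hzv : z = v := by
      by_contra hne
      exact hirr ⟨z - v, v, hsub, hvC, sub_ne_zero.2 hne, hv0, (sub_add_cancel z v).symm⟩
    rw [hzv]
    exact Finset.single_le_sum (f := fun y => ‖toR y‖) (fun _ _ => norm_nonneg _) hv
  · push Not at h
    rw [Set.mem_ofPred_eq, ← ha]
    refine (norm_sum_le _ _).trans (Finset.sum_le_sum fun v hv => ?_)
    by_cases hv0 : v = 0
    · simp [hv0, toR_zero]
    rw [hsmul, norm_smul, Real.norm_of_nonneg (a v).coe_nonneg]
    exact mul_le_of_le_one_left (norm_nonneg _) (h v hv hv0).le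

lemma mem_closure_hilbC {C : Set (Fin d → ℝ)} (hC : IsRatCone C) (hp : PointedSet C)
    {z : Fin d → ℤ} (hz : toR z ∈ C) : z ∈ AddSubmonoid.closure (hilbC C) := by
  obtain ⟨B, rfl⟩ := hC
  obtain ⟨f, hf⟩ := exists_norm_le_functional hp
  have hf1 {w : Fin d → ℤ} (hw : toR w ∈ coneSet (B : Set (Fin d → ℤ))) (hw0 : w ≠ 0) :
      1 ≤ f (toR w) := (one_le_norm_toR hw0).trans (hf _ hw)
  obtain ⟨n, hn⟩ := exists_nat_gt (f (toR z))
  induction n generalizing z with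
  | zero =>
    have := (norm_nonneg _).trans (hf _ hz)
    norm_num at hn
    linarith
  | succ n ih =>
    by_cases hz0 : z = 0
    · exact hz0 ▸ zero_mem _
    by_cases hzH : z ∈ hilbC (coneSet (B : Set (Fin d → ℤ)))
    · exact AddSubmonoid.subset_closure hzH
    have : ∃ u v : Fin d → ℤ, toR u ∈ coneSet (B : Set (Fin d → ℤ)) ∧
        toR v ∈ coneSet (B : Set (Fin d → ℤ)) ∧ u ≠ 0 ∧ v ≠ 0 ∧ z = u + v := by
      by_contra h
      exact hzH ⟨hz, hz0, h⟩
    obtain ⟨u, v, hu, hv, hu0, hv0, rfl⟩ := this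
    rw [toR_add, map_add] at hn
    push_cast at hn
    have h1 := hf1 hu hu0
    have h2 := hf1 hv hv0
    exact add_mem (ih hu (by linarith)) (ih hv (by linarith))

end ConeSet

section Projection

variable {d e : ℕ}

lemma exists_surjective_ker_eq_span {x : Fin (e + 1) → ℤ} (hx : x ≠ 0)
    (hprim : ∀ (w : Fin (e + 1) → ℤ) (n m : ℤ), n ≠ 0 → n • w = m • x → ∃ k : ℤ, w = k • x) :
    ∃ π : (Fin (e + 1) → ℤ) →ₗ[ℤ] (Fin e → ℤ), Function.Surjective π ∧
      LinearMap.ker π = Submodule.span ℤ {x} := by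
  set N := Submodule.span ℤ {x}
  have : Module.IsTorsionFree ℤ ((Fin (e + 1) → ℤ) ⧸ N) := by
    refine .of_smul_eq_zero fun n q hq => ?_
    obtain ⟨w, rfl⟩ := N.mkQ_surjective q
    by_cases hn : n = 0
    · exact Or.inl hn
    rw [← map_smul, Submodule.mkQ_apply, Submodule.Quotient.mk_eq_zero,
      Submodule.mem_span_singleton] at hq
    obtain ⟨m, hm⟩ := hq
    obtain ⟨k, rfl⟩ := hprim w n m hn hm.symm
    right
    rw [Submodule.mkQ_apply, Submodule.Quotient.mk_eq_zero]
    exact Submodule.smul_mem _ _ (Submodule.mem_span_singleton_self x)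
  have hN : Module.finrank ℤ N = 1 := by
    rw [← (LinearEquiv.toSpanNonzeroSingleton ℤ _ x hx).finrank_eq, Module.finrank_self]
  have hrank := N.finrank_quotient_add_finrank
  rw [hN, Module.finrank_fin_fun, Nat.add_right_cancel_iff] at hrank
  let φ : ((Fin (e + 1) → ℤ) ⧸ N) ≃ₗ[ℤ] (Fin e → ℤ) :=
    LinearEquiv.ofFinrankEq _ _ (by rw [hrank, Module.finrank_fin_fun])
  refine ⟨φ.toLinearMap ∘ₗ N.mkQ, φ.surjective.comp N.mkQ_surjective, ?_⟩
  rw [LinearEquiv.ker_comp, Submodule.ker_mkQ]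

lemma exists_real_extension (π : (Fin d → ℤ) →ₗ[ℤ] (Fin e → ℤ)) (hπ : Function.Surjective π) :
    ∃ ρ : (Fin d → ℝ) →ₗ[ℝ] (Fin e → ℝ), Function.Surjective ρ ∧ ∀ w, ρ (toR w) = toR (π w) := by
  obtain ⟨σ, hσ⟩ := π.exists_rightInverse_of_surjective (LinearMap.range_eq_top.2 hπ)
  let ext {m n : ℕ} (τ : (Fin m → ℤ) →ₗ[ℤ] (Fin n → ℤ)) : (Fin m → ℝ) →ₗ[ℝ] (Fin n → ℝ) :=
    Matrix.toLin' ((LinearMap.toMatrix' τ).map (Int.castRingHom ℝ))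
  refine ⟨ext π, ?_, fun w => ?_⟩
  · have h : ext π ∘ₗ ext σ = LinearMap.id := by
      simp only [ext]
      rw [← Matrix.toLin'_mul, ← Matrix.map_mul, ← LinearMap.toMatrix'_comp, hσ]
      simp
    exact fun y => ⟨ext σ y, LinearMap.congr_fun h y⟩
  · conv_rhs => rw [← LinearMap.toMatrix'_mulVec π w]
    have h := RingHom.map_mulVec (Int.castRingHom ℝ) (LinearMap.toMatrix' π) w
    ext i
    exact (h i).symm

lemma exists_smul_of_map_eq_zero {ρ : (Fin (e + 1) → ℝ) →ₗ[ℝ] (Fin e → ℝ)}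
    (hρ : Function.Surjective ρ) {x : Fin (e + 1) → ℝ} (hx : x ≠ 0) (hρx : ρ x = 0)
    {c : Fin (e + 1) → ℝ} (hc : ρ c = 0) : ∃ t : ℝ, c = t • x := by
  have h := ρ.finrank_range_add_finrank_ker
  rw [LinearMap.range_eq_top.2 hρ, finrank_top, Module.finrank_fin_fun, Module.finrank_fin_fun,
    Nat.add_left_cancel_iff] at h
  obtain ⟨t, ht⟩ := (finrank_eq_one_iff_of_nonzero' (⟨x, hρx⟩ : LinearMap.ker ρ)
    (by simpa [Subtype.ext_iff] using hx)).1 h ⟨c, hc⟩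
  exact ⟨t, (congrArg Subtype.val ht).symm⟩

end Projection

section HilbertBasis

variable {d e : ℕ} {C : Set (Fin d → ℝ)}

lemma coneSet_subset {B : Set (Fin d → ℤ)} (hC : IsRatCone C) (h : ∀ b ∈ B, toR b ∈ C) :
    coneSet B ⊆ C := by
  obtain ⟨K, rfl⟩ := hC.exists_submodule
  rw [coneSet_eq_span, SetLike.coe_subset_coe, Submodule.span_le]
  rintro _ ⟨b, hb, rfl⟩
  exact h b hb

lemma coneSet_hilbC (hC : IsRatCone C) (hp : PointedSet C) : coneSet (hilbC C) = C := by
  refine (coneSet_subset hC fun b hb => hb.1).antisymm ?_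
  have hlat {z : Fin d → ℤ} (hz : toR z ∈ C) : toR z ∈ coneSet (hilbC C) := by
    rw [coneSet_eq_span]
    have hcl := mem_closure_hilbC hC hp hz
    clear hz
    induction hcl using AddSubmonoid.closure_induction with
    | mem w hw => exact Submodule.subset_span ⟨w, hw, rfl⟩
    | zero => exact toR_zero (d := d) ▸ zero_mem _
    | add u v _ _ hu hv => exact toR_add u v ▸ add_mem hu hv
  obtain ⟨B, hB⟩ := hC
  have hBC (b) (hb : b ∈ B) : toR b ∈ C := by
    rw [hB, coneSet_eq_span]
    exact Submodule.subset_span ⟨b, hb, rfl⟩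
  nth_rw 1 [hB]
  rw [coneSet_eq_span, coneSet_eq_span, SetLike.coe_subset_coe, Submodule.span_le,
    ← coneSet_eq_span]
  rintro _ ⟨b, hb, rfl⟩
  exact hlat (hBC b hb)

lemma exists_eq_smul_add_of_mem (hC : IsRatCone C) (hp : PointedSet C) {x : Fin d → ℤ}
    (hx : x ∈ hilbC C) {c : Fin d → ℝ} (hc : c ∈ C) :
    ∃ α : ℝ, 0 ≤ α ∧ ∃ p ∈ coneSet (hilbC C \ {x}), c = α • toR x + p := by
  rw [← coneSet_hilbC hC hp, ← Set.insert_sdiff_self_of_mem hx, coneSet_eq_span, Set.image_insert_eq,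
    SetLike.mem_coe, Submodule.mem_span_insert] at hc
  obtain ⟨α, p, hp, rfl⟩ := hc
  exact ⟨α, α.2, p, by rwa [coneSet_eq_span], rfl⟩

lemma exists_zsmul_of_mem_hilbC (hC : IsRatCone C) {x : Fin d → ℤ} (hx : x ∈ hilbC C)
    {w : Fin d → ℤ} {n m : ℤ} (hn : n ≠ 0) (h : n • w = m • x) : ∃ k : ℤ, w = k • x := by
  obtain ⟨K, rfl⟩ := hC.exists_submodule
  obtain ⟨hxK, hx0, hirr⟩ := hx
  have hw : toR w = ((m : ℝ) / n) • toR x := by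
    have hn' : (n : ℝ) ≠ 0 := by exact_mod_cast hn
    have h' := congrArg toR h
    rw [toR_zsmul, toR_zsmul] at h'
    rw [div_eq_inv_mul, mul_smul, ← h', smul_smul, inv_mul_cancel₀ hn', one_smul]
  set q : ℝ := (m : ℝ) / n
  have hu : toR (w - ⌊q⌋ • x) = Int.fract q • toR x := by
    rw [toR_sub, toR_zsmul, hw, ← sub_smul, Int.self_sub_floor]
  have hv : toR (x - (w - ⌊q⌋ • x)) = (1 - Int.fract q) • toR x := by
    rw [toR_sub, hu, sub_smul, one_smul]
  have hpos : 0 < 1 - Int.fract q := sub_pos.2 (Int.fract_lt_one q)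
  refine ⟨⌊q⌋, ?_⟩
  by_contra hne
  refine hirr ⟨w - ⌊q⌋ • x, x - (w - ⌊q⌋ • x), ?_, ?_, sub_ne_zero.2 hne, ?_, by abel⟩
  · rw [hu]
    exact Submodule.real_smul_mem hxK (Int.fract_nonneg q)
  · rw [hv]
    exact Submodule.real_smul_mem hxK hpos.le
  · rw [Ne, ← toR_eq_zero, hv, smul_eq_zero, toR_eq_zero]
    exact not_or.2 ⟨hpos.ne', hx0⟩

lemma toR_notMem_coneSet_sdiff (hC : IsRatCone C) {x : Fin d → ℤ} (hx : x ∈ hilbC C)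
    (h : hilbC (coneSet (hilbC C \ {x})) = hilbC C \ {x}) :
    toR x ∉ coneSet (hilbC C \ {x}) := by
  have hsub : coneSet (hilbC C \ {x}) ⊆ C := coneSet_subset hC fun b hb => hb.1.1
  intro hxC
  have : x ∈ hilbC (coneSet (hilbC C \ {x})) :=
    ⟨hxC, hx.2.1, fun ⟨u, v, hu, hv, huv⟩ => hx.2.2 ⟨u, v, hsub hu, hsub hv, huv⟩⟩
  rw [h] at this
  exact this.2 rfl

lemma IsRatCone.image (hC : IsRatCone C) {π : (Fin d → ℤ) →ₗ[ℤ] (Fin e → ℤ)}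
    {ρ : (Fin d → ℝ) →ₗ[ℝ] (Fin e → ℝ)} (hρ : ∀ w, ρ (toR w) = toR (π w)) :
    IsRatCone (ρ '' C) := by
  classical
  obtain ⟨B, rfl⟩ := hC
  refine ⟨B.image π, ?_⟩
  rw [coneSet_eq_span, coneSet_eq_span]
  have := Submodule.map_span (ρ.restrictScalars ℝ≥0) (toR '' (B : Set (Fin d → ℤ)))
  rw [Finset.coe_image, Set.image_image]
  simp_rw [← hρ]
  rw [Set.image_image] at this
  exact congrArg SetLike.coe this

lemma FullDim.image (hC : FullDim C) {ρ : (Fin d → ℝ) →ₗ[ℝ] (Fin e → ℝ)}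
    (hρ : Function.Surjective ρ) : FullDim (ρ '' C) := by
  rw [FullDim, Submodule.span_image, hC, Submodule.map_top, LinearMap.range_eq_top.2 hρ]

lemma PointedSet.image_of_ker_eq (hC : IsRatCone C) (hp : PointedSet C) {x : Fin d → ℤ}
    (hx : x ∈ hilbC C) (hxC : toR x ∉ coneSet (hilbC C \ {x}))
    {ρ : (Fin d → ℝ) →ₗ[ℝ] (Fin e → ℝ)} (hρx : ρ (toR x) = 0)
    (hρ : ∀ c, ρ c = 0 → ∃ t : ℝ, c = t • toR x) : PointedSet (ρ '' C) := by
  rintro _ ⟨c, hc, rfl⟩ ⟨c', hc', hcc'⟩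
  obtain ⟨α, -, p, hpm, rfl⟩ := exists_eq_smul_add_of_mem hC hp hx hc
  obtain ⟨β, -, q, hqm, rfl⟩ := exists_eq_smul_add_of_mem hC hp hx hc'
  simp only [map_add, map_smul, hρx, smul_zero, zero_add] at hcc' ⊢
  obtain ⟨s, hs⟩ := hρ (p + q) (by rw [map_add, hcc', add_neg_cancel])
  have hsub : coneSet (hilbC C \ {x}) ⊆ C := coneSet_subset hC fun b hb => hb.1.1
  obtain hs0 | hs0 := lt_or_ge 0 s
  · refine absurd ?_ hxC
    have : toR x = s⁻¹ • (p + q) := by rw [hs, smul_smul, inv_mul_cancel₀ hs0.ne', one_smul]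
    rw [coneSet_eq_span] at hpm hqm ⊢
    rw [this]
    exact Submodule.real_smul_mem (add_mem hpm hqm) (inv_nonneg.2 hs0.le)
  · have hpC := hsub hpm
    have hneg : -p = q + (-s) • toR x := by
      rw [neg_smul, ← hs]
      abel
    obtain ⟨K, rfl⟩ := hC.exists_submodule
    rw [hp p hpC, map_zero]
    rw [hneg]
    exact add_mem (hsub hqm) (Submodule.real_smul_mem hx.1 (neg_nonneg.2 hs0))

lemma exists_mem_hilbC_map_eq (hC : IsRatCone C) (hp : PointedSet C) {x : Fin d → ℤ}
    (hx : x ∈ hilbC C) {π : (Fin d → ℤ) →ₗ[ℤ] (Fin e → ℤ)} (hπ : Function.Surjective π)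
    {ρ : (Fin d → ℝ) →ₗ[ℝ] (Fin e → ℝ)} (hπx : π x = 0) (hρπ : ∀ w, ρ (toR w) = toR (π w))
    (hρ : ∀ c, ρ c = 0 → ∃ t : ℝ, c = t • toR x) {g : Fin e → ℤ} (hg : g ∈ hilbC (ρ '' C)) :
    ∃ h ∈ hilbC C, π h = g := by
  obtain ⟨⟨c, hc, hcg⟩, hg0, hirr⟩ := hg
  obtain ⟨w, hw⟩ := hπ g
  obtain ⟨t, ht⟩ := hρ (toR w - c) (by rw [map_sub, hρπ, hw, hcg, sub_self])
  obtain ⟨n, hn⟩ := exists_int_gt (-t)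
  have hmem : toR (w + n • x) ∈ C := by
    have : toR (w + n • x) = c + (t + n) • toR x := by
      rw [toR_add, toR_zsmul, add_smul, ← ht]
      abel
    rw [this]
    have hxC := hx.1
    obtain ⟨K, rfl⟩ := hC.exists_submodule
    exact add_mem hc (Submodule.real_smul_mem hxC (by linarith))
  have hlift : π (w + n • x) = g := by rw [map_add, map_smul, hπx, smul_zero, add_zero, hw]
  have hclos : ∀ y ∈ AddSubmonoid.closure (hilbC C), toR y ∈ C := fun y hy => by
    have hH (b) (hb : b ∈ hilbC C) : toR b ∈ C := hb.1
    obtain ⟨K, rfl⟩ := hC.exists_submodule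
    induction hy using AddSubmonoid.closure_induction with
    | mem b hb => exact hH b hb
    | zero => exact toR_zero (d := d) ▸ zero_mem K
    | add u v _ _ hu hv => exact toR_add u v ▸ add_mem hu hv
  have hcl := mem_closure_hilbC hC hp hmem
  generalize w + n • x = y at hcl hlift
  induction hcl using AddSubmonoid.closure_induction with
  | mem b hb => exact ⟨b, hb, hlift⟩
  | zero => exact absurd (hlift.symm.trans (map_zero π)) hg0
  | add u v hu hv ihu ihv =>
    rw [map_add] at hlift
    by_cases hu0 : π u = 0
    · exact ihv (by rwa [hu0, zero_add] at hlift)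
    by_cases hv0 : π v = 0
    · exact ihu (by rwa [hv0, add_zero] at hlift)
    exact absurd ⟨π u, π v, ⟨_, hclos u hu, hρπ u⟩, ⟨_, hclos v hv, hρπ v⟩, hu0, hv0,
      hlift.symm⟩ hirr

end HilbertBasis

/-- Either a lattice point is an integral combination of few Hilbert basis elements, obtained by
lifting such a combination from the projection along `x`, or it becomes an element of the cone
over the remaining Hilbert basis elements after adding a positive multiple of `x`. -/
lemma exists_combination_or_add_smul_mem {e : ℕ} {C : Set (Fin (e + 1) → ℝ)} (hC : IsRatCone C)
    (hp : PointedSet C) (hf : FullDim C) {x : Fin (e + 1) → ℤ} (hx : x ∈ hilbC C)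
    (hxC : toR x ∉ coneSet (hilbC C \ {x}))
    (hdim : ∀ C' : Set (Fin e → ℝ), IsRatCone C' → PointedSet C' → FullDim C' → ICPcone C')
    {z : Fin (e + 1) → ℤ} (hz : toR z ∈ C) :
    (∃ (s : Finset (Fin (e + 1) → ℤ)) (a : (Fin (e + 1) → ℤ) → ℕ),
      (s : Set (Fin (e + 1) → ℤ)) ⊆ hilbC C ∧ s.card ≤ e + 1 ∧ z = ∑ y ∈ s, a y • y) ∨
    ∃ b : ℝ, 0 < b ∧ toR z + b • toR x ∈ coneSet (hilbC C \ {x}) := by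
  classical
  obtain ⟨π, hπ, hker⟩ := exists_surjective_ker_eq_span hx.2.1
    fun w n m hn h => exists_zsmul_of_mem_hilbC hC hx hn h
  have hπx : π x = 0 := by
    rw [← LinearMap.mem_ker, hker]
    exact Submodule.mem_span_singleton_self x
  obtain ⟨ρ, hρ, hρπ⟩ := exists_real_extension π hπ
  have hρx : ρ (toR x) = 0 := by rw [hρπ, hπx, toR_zero]
  have hρker (c) (hc : ρ c = 0) : ∃ t : ℝ, c = t • toR x :=
    exists_smul_of_map_eq_zero hρ (toR_eq_zero.not.2 hx.2.1) hρx hc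
  obtain ⟨s, a, hs, hcard, hsum⟩ := hdim (ρ '' C) (hC.image hρπ)
    (hp.image_of_ker_eq hC hx hxC hρx hρker) (hf.image hρ) (π z) ⟨_, hz, hρπ z⟩
  choose! l hlH hl using fun g (hg : g ∈ hilbC (ρ '' C)) =>
    exists_mem_hilbC_map_eq hC hp hx hπ hπx hρπ hρker hg
  have hlx (g) (hg : g ∈ s) : l g ≠ x := by
    intro h
    have := hl g (hs hg)
    rw [h, hπx] at this
    exact (hs hg).2.1 this.symm
  obtain ⟨b, hb⟩ : ∃ b : ℤ, b • x = z - ∑ g ∈ s, a g • l g := by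
    rw [← Submodule.mem_span_singleton, ← hker, LinearMap.mem_ker, map_sub, hsum, map_sum,
      sub_eq_zero]
    refine Finset.sum_congr rfl fun g hg => ?_
    rw [map_nsmul, hl g (hs hg)]
  obtain hb0 | hb0 := le_or_gt 0 b
  · left
    have hinj : Set.InjOn l s := fun g hg g' hg' h => by
      rw [← hl g (hs hg), ← hl g' (hs hg'), h]
    have hnot : x ∉ s.image l := by
      simpa using hlx
    refine ⟨insert x (s.image l), fun w => if w = x then b.toNat else a (π w), ?_, ?_, ?_⟩
    · rw [Finset.coe_insert, Finset.coe_image, Set.insert_subset_iff, Set.image_subset_iff]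
      exact ⟨hx, fun g hg => hlH g (hs hg)⟩
    · exact (Finset.card_insert_le _ _).trans
        (Nat.succ_le_succ (Finset.card_image_le.trans hcard))
    · rw [Finset.sum_insert hnot, Finset.sum_image hinj]
      simp only [if_true]
      have hsl : ∑ g ∈ s, (if l g = x then b.toNat else a (π (l g))) • l g = ∑ g ∈ s, a g • l g :=
        Finset.sum_congr rfl fun g hg => by rw [if_neg (hlx g hg), hl g (hs hg)]
      rw [← natCast_zsmul, Int.toNat_of_nonneg hb0, hb, hsl, sub_add_cancel]
  · right
    refine ⟨-b, by exact_mod_cast neg_pos.2 hb0, ?_⟩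
    have : toR z + (-(b : ℝ)) • toR x = toR (∑ g ∈ s, a g • l g) := by
      rw [neg_smul, ← sub_eq_add_neg, ← toR_zsmul, ← toR_sub, hb, sub_sub_cancel]
    rw [this, coneSet_eq_span]
    refine Finset.sum_induction _ (fun w => toR w ∈ Submodule.span ℝ≥0 (toR '' (hilbC C \ {x})))
      (fun u v hu hv => toR_add u v ▸ add_mem hu hv) (toR_zero (d := e + 1) ▸ zero_mem _) ?_
    intro g hg
    rw [← natCast_zsmul, toR_zsmul]
    have hmem : toR (l g) ∈ Submodule.span ℝ≥0 (toR '' (hilbC C \ {x})) :=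
      Submodule.subset_span ⟨l g, ⟨hlH g (hs hg), hlx g hg⟩, rfl⟩
    exact Submodule.real_smul_mem hmem (by positivity)

/-- Lemma 4.1 for (ICP): a counterexample to (ICP), minimal first with respect
to dimension and second with respect to the size of its Hilbert basis, is
tight. -/
theorem tight_of_minimal_ICP_counterexample {d : ℕ} (C : Set (Fin d → ℝ))
    (hC : IsRatCone C) (hp : PointedSet C) (hf : FullDim C)
    (hnot : ¬ ICPcone C)
    (hmindim : ∀ e, e < d → ∀ C' : Set (Fin e → ℝ),
      IsRatCone C' → PointedSet C' → FullDim C' → ICPcone C')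
    (hmincard : ∀ C' : Set (Fin d → ℝ),
      IsRatCone C' → PointedSet C' → FullDim C' →
      (hilbC C').ncard < (hilbC C).ncard → ICPcone C') :
    Tight C := by
  intro x hx heq
  refine hnot fun z hz => ?_
  have hxC := toR_notMem_coneSet_sdiff hC hx heq
  have hfin := finite_hilbC hC
  obtain ⟨e, rfl⟩ : ∃ e, d = e + 1 := by
    refine Nat.exists_eq_succ_of_ne_zero ?_
    rintro rfl
    exact hx.2.1 (Subsingleton.elim _ _)
  obtain h | ⟨b, hb, hq⟩ := exists_combination_or_add_smul_mem hC hp hf hx hxC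
    (hmindim e e.lt_succ_self) hz
  · exact h
  have hsub : coneSet (hilbC C \ {x}) ⊆ C := coneSet_subset hC fun w hw => hw.1.1
  obtain ⟨α, hα, p, hpm, hzp⟩ := exists_eq_smul_add_of_mem hC hp hx hz
  have hpos : 0 < b + α := by linarith
  have hzC : toR z ∈ coneSet (hilbC C \ {x}) := by
    have : toR z = (b + α)⁻¹ • (b • p + α • (toR z + b • toR x)) := by
      rw [eq_inv_smul_iff₀ hpos.ne', hzp]
      module
    rw [coneSet_eq_span] at hpm hq ⊢
    rw [this]
    exact Submodule.real_smul_mem (add_mem (Submodule.real_smul_mem hpm hb.le)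
      (Submodule.real_smul_mem hq hα)) (inv_nonneg.2 hpos.le)
  have hfull : FullDim (coneSet (hilbC C \ {x})) := by
    set V := Submodule.span ℝ (coneSet (hilbC C \ {x}))
    have hxV : toR x ∈ V := by
      have : toR x = b⁻¹ • (toR z + b • toR x - toR z) := by
        rw [add_sub_cancel_left, smul_smul, inv_mul_cancel₀ hb.ne', one_smul]
      rw [this]
      exact V.smul_mem _ (sub_mem (Submodule.subset_span hq) (Submodule.subset_span hzC))
    rw [FullDim, eq_top_iff, ← hf, Submodule.span_le]
    intro c hc
    obtain ⟨β, -, q, hqm, rfl⟩ := exists_eq_smul_add_of_mem hC hp hx hc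
    exact add_mem (V.smul_mem _ hxV) (Submodule.subset_span hqm)
  have hrat : IsRatCone (coneSet (hilbC C \ {x})) :=
    ⟨(hfin.subset Set.sdiff_subset).toFinset, by rw [Set.Finite.coe_toFinset]⟩
  obtain ⟨s, a, hs, hcard, hsum⟩ := hmincard _ hrat (fun c hc hc' => hp c (hsub hc) (hsub hc')) hfull
    (by rw [heq]; exact Set.ncard_sdiff_singleton_lt_of_mem hx hfin) z hzC
  rw [heq] at hs
  exact ⟨s, a, hs.trans Set.sdiff_subset, hcard, hsum⟩
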